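/- S1 is homotopy equivalent to the doubled grid 2G: there exists a homotopy equivalence between the subspaces S1 and 2G of ℝ³ (each equipped with the subspace topology). -/

import Mathlib

/-- The closed unit cube `[-1/2, 1/2]³` centered at the origin in `ℝ³`. -/
def unitCube : Set (Fin 3 → ℝ) := {x | ∀ i, x i ∈ Set.Icc (-(1/2) : ℝ) (1/2)}

/-- `L1`: integer points with at most one odd coordinate. -/
def L1 : Set (Fin 3 → ℤ) := {p | ∀ i j, Odd (p i) → Odd (p j) → i = j}

/-- `S1`: the union of the cubes centered at points of `L1`. -/
def S1 : Set (Fin 3 → ℝ) := ⋃ p ∈ L1, (fun c => c + fun i => (p i : ℝ)) '' unitCube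

/-- The doubled grid `2G`: points of `ℝ³` having at least two coordinates that
are even integers. -/
def doubledGrid : Set (Fin 3 → ℝ) :=
  {x | ∃ i j : Fin 3, i ≠ j ∧ (∃ m : ℤ, x i = 2 * m) ∧ (∃ m : ℤ, x j = 2 * m)}

/-- A self-map of a subset of a topological vector space joined to the identity by segments
inside the subset is homotopic to the identity. -/
theorem ContinuousMap.homotopic_id_of_segment_subset {E : Type*} [AddCommGroup E] [Module ℝ E]
    [TopologicalSpace E] [ContinuousAdd E] [ContinuousSMul ℝ E] {A : Set E} (f : C(A, A))
    (h : ∀ x : A, segment ℝ (f x : E) x ⊆ A) : f.Homotopic (ContinuousMap.id A) :=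
  ⟨{ toFun := fun q => ⟨(1 - (q.1 : ℝ)) • (f q.2 : E) + (q.1 : ℝ) • (q.2 : E),
        h q.2 ⟨_, _, sub_nonneg.2 q.1.2.2, q.1.2.1, sub_add_cancel _ _, rfl⟩⟩
     continuous_toFun := by fun_prop
     map_zero_left := fun x => by ext; simp
     map_one_left := fun x => by ext; simp }⟩

/-- The map `ℝ → ℝ` collapsing each interval `[2m - 1/2, 2m + 1/2]` to `2m` and stretching each
complementary interval `[2m + 1/2, 2m + 3/2]` affinely onto `[2m, 2m + 2]`. -/
noncomputable def snapEven (x : ℝ) : ℝ :=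
  x + 2 * (max 0 (min 1 (2 * Int.fract (x / 2) - 1 / 2)) - Int.fract (x / 2))

theorem continuous_snapEven : Continuous snapEven := by
  have h : Continuous ((fun t : ℝ => max 0 (min 1 (2 * t - 1 / 2)) - t) ∘ Int.fract) :=
    ContinuousOn.comp_fract'' (by fun_prop) (by norm_num)
  exact continuous_id.add (continuous_const.mul (h.comp (continuous_id.div_const 2)))

theorem snapEven_eq {x : ℝ} {m : ℤ} (h : |x - 2 * m| ≤ 1 / 2) : snapEven x = 2 * m := by
  rw [abs_le] at h
  unfold snapEven
  rcases le_or_gt (2 * (m : ℝ)) x with hx | hx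
  · have hf : ⌊x / 2⌋ = m := Int.floor_eq_iff.2 ⟨by linarith, by linarith⟩
    rw [Int.fract, hf, min_eq_right (by linarith), max_eq_left (by linarith)]
    ring
  · have hf : ⌊x / 2⌋ = m - 1 :=
      Int.floor_eq_iff.2 ⟨by push_cast; linarith, by push_cast; linarith⟩
    rw [Int.fract, hf, min_eq_left (by push_cast; linarith), max_eq_right zero_le_one]
    push_cast
    ring

/-- `S1` consists of the points with two coordinates within `1/2` of an even integer. -/
theorem mem_S1_iff {x : Fin 3 → ℝ} :
    x ∈ S1 ↔ ∃ i j : Fin 3, i ≠ j ∧ (∃ m : ℤ, |x i - 2 * m| ≤ 1 / 2) ∧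
      (∃ m : ℤ, |x j - 2 * m| ≤ 1 / 2) := by
  constructor
  · intro hx
    simp only [S1, Set.mem_iUnion, Set.mem_image] at hx
    obtain ⟨p, hp, c, hc, rfl⟩ := hx
    have near : ∀ i, Even (p i) → ∃ m : ℤ, |(c + fun i => (p i : ℝ)) i - 2 * m| ≤ 1 / 2 := by
      rintro i ⟨m, hm⟩
      refine ⟨m, ?_⟩
      have := hc i
      simp only [Pi.add_apply, hm, Int.cast_add]
      rw [abs_le]
      constructor <;> linarith [this.1, this.2]
    have hex : ∃ i j : Fin 3, i ≠ j ∧ Even (p i) ∧ Even (p j) := by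
      by_contra! hcon
      have even_or_even : ∀ i j, i ≠ j → Even (p i) ∨ Even (p j) := by
        intro i j hij
        by_contra! h
        exact hij (hp i j (by simpa using h.1) (by simpa using h.2))
      rcases even_or_even 0 1 (by decide) with h | h
      · rcases even_or_even 1 2 (by decide) with h' | h'
        · exact hcon 0 1 (by decide) h h'
        · exact hcon 0 2 (by decide) h h'
      · rcases even_or_even 0 2 (by decide) with h' | h'
        · exact hcon 0 1 (by decide) h' h
        · exact hcon 1 2 (by decide) h h'
    obtain ⟨i, j, hij, hi, hj⟩ := hex
    exact ⟨i, j, hij, near i hi, near j hj⟩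
  · rintro ⟨i, j, hij, hi, hj⟩
    have center : ∀ k, ∃ n : ℤ, |x k - n| ≤ 1 / 2 ∧
        ((∃ m : ℤ, |x k - 2 * m| ≤ 1 / 2) → Even n) := by
      intro k
      by_cases hk : ∃ m : ℤ, |x k - 2 * m| ≤ 1 / 2
      · obtain ⟨m, hm⟩ := hk
        exact ⟨2 * m, by simpa using hm, fun _ => even_two_mul m⟩
      · exact ⟨round (x k), abs_sub_round _, fun h => absurd h hk⟩
    choose p hp hpe using center
    simp only [S1, Set.mem_iUnion, Set.mem_image]
    refine ⟨p, ?_, fun k => x k - p k, fun k => abs_le.1 (hp k), ?_⟩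
    · intro k l hk hl
      have off : ∀ k, Odd (p k) → k ≠ i ∧ k ≠ j := by
        intro k hk
        constructor <;> rintro rfl
        · exact Int.not_even_iff_odd.2 hk (hpe _ hi)
        · exact Int.not_even_iff_odd.2 hk (hpe _ hj)
      have := off k hk
      have := off l hl
      omega
    · ext k
      simp

theorem doubledGrid_subset_S1 : doubledGrid ⊆ S1 := by
  rintro x ⟨i, j, hij, ⟨m, hm⟩, n, hn⟩
  exact mem_S1_iff.2 ⟨i, j, hij, ⟨m, by simp [hm]⟩, n, by simp [hn]⟩

theorem snapEven_comp_mem_doubledGrid {x : Fin 3 → ℝ} (hx : x ∈ S1) :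
    snapEven ∘ x ∈ doubledGrid := by
  obtain ⟨i, j, hij, ⟨m, hm⟩, n, hn⟩ := mem_S1_iff.1 hx
  exact ⟨i, j, hij, ⟨m, snapEven_eq hm⟩, n, snapEven_eq hn⟩

theorem segment_snapEven_subset_S1 {x : Fin 3 → ℝ} (hx : x ∈ S1) :
    segment ℝ (snapEven ∘ x) x ⊆ S1 := by
  rintro y ⟨a, b, ha, hb, hab, rfl⟩
  have near : ∀ k, (∃ m : ℤ, |x k - 2 * m| ≤ 1 / 2) →
      ∃ m : ℤ, |(a • (snapEven ∘ x) + b • x) k - 2 * m| ≤ 1 / 2 := by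
    rintro k ⟨m, hm⟩
    refine ⟨m, ?_⟩
    have h : (a • (snapEven ∘ x) + b • x) k - 2 * m = b * (x k - 2 * m) := by
      simp only [Pi.add_apply, Pi.smul_apply, Function.comp_apply, smul_eq_mul, snapEven_eq hm]
      linear_combination (2 * (m : ℝ)) * hab
    rw [h, abs_mul, abs_of_nonneg hb]
    exact (mul_le_of_le_one_left (abs_nonneg _) (by linarith)).trans hm
  obtain ⟨i, j, hij, hi, hj⟩ := mem_S1_iff.1 hx
  exact mem_S1_iff.2 ⟨i, j, hij, near i hi, near j hj⟩

theorem segment_snapEven_subset_doubledGrid {x : Fin 3 → ℝ} (hx : x ∈ doubledGrid) :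
    segment ℝ (snapEven ∘ x) x ⊆ doubledGrid := by
  rintro y ⟨a, b, ha, hb, hab, rfl⟩
  have fixed : ∀ k, (∃ m : ℤ, x k = 2 * m) →
      ∃ m : ℤ, (a • (snapEven ∘ x) + b • x) k = 2 * m := by
    rintro k ⟨m, hm⟩
    have hs : snapEven (x k) = 2 * m := snapEven_eq (by simp [hm])
    refine ⟨m, ?_⟩
    simp only [Pi.add_apply, Pi.smul_apply, Function.comp_apply, smul_eq_mul, hs]
    rw [hm]
    linear_combination (2 * (m : ℝ)) * hab
  obtain ⟨i, j, hij, hi, hj⟩ := hx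
  exact ⟨i, j, hij, fixed i hi, fixed j hj⟩

/-- `S1` is homotopy equivalent to the doubled grid `2G` (as subspaces of `ℝ³`
with the subspace topology). -/
theorem S1_homotopyEquiv_doubledGrid :
    Nonempty (ContinuousMap.HomotopyEquiv S1 doubledGrid) := by
  have hc : Continuous fun x : S1 => snapEven ∘ (x : Fin 3 → ℝ) :=
    continuous_pi fun i =>
      continuous_snapEven.comp ((continuous_apply i).comp continuous_subtype_val)
  exact ⟨{
    toFun := ⟨fun x => ⟨snapEven ∘ x, snapEven_comp_mem_doubledGrid x.2⟩, hc.subtype_mk _⟩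
    invFun := ⟨Set.inclusion doubledGrid_subset_S1, continuous_inclusion _⟩
    left_inv := ContinuousMap.homotopic_id_of_segment_subset _
      fun x => segment_snapEven_subset_S1 x.2
    right_inv := ContinuousMap.homotopic_id_of_segment_subset _
      fun x => segment_snapEven_subset_doubledGrid x.2 }⟩
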